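/- Let (W,S) be a Coxeter system and J ⊆ S. If f : W → W is a compulsive map (i.e., f(w) ≤_R w and f(w) ≤_R ws for every w ∈ W and every right descent s of w), then for every w ∈ W, ᴶ(f(w)) ≤_R Pop(ᴶw). -/

import Mathlib

namespace CoxPop

variable {B W : Type*} [Group W] {M : CoxeterMatrix B} (cs : CoxeterSystem M W)

/-- The standard parabolic subgroup generated by the simple reflections indexed by `J`. -/
def parabolic (J : Set B) : Subgroup W :=
  Subgroup.closure (cs.simple '' J)

/-- The right descent set of `w`. -/
def D (w : W) : Set B := {i | cs.IsRightDescent w i}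

/-- `u` is a longest element of the standard parabolic subgroup `W_J`. -/
def IsLongestIn (J : Set B) (u : W) : Prop :=
  u ∈ parabolic cs J ∧ ∀ v ∈ parabolic cs J, cs.length v ≤ cs.length u

open Classical in
/-- The longest element `w₀(J)` of the standard parabolic subgroup `W_J`. -/
noncomputable def w0 (J : Set B) : W :=
  if h : ∃ u, IsLongestIn cs J u then h.choose else 1

/-- The Coxeter pop-stack-sorting operator: `Pop w = w * w₀(D_R(w))`. -/
noncomputable def Pop (w : W) : W := w * w0 cs (D cs w)

/-- The right weak order on `W`: `x ≤_R y` iff `ℓ(x) + ℓ(x⁻¹y) = ℓ(y)`. -/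
def rweakLE (x y : W) : Prop := cs.length x + cs.length (x⁻¹ * y) = cs.length y

/-- `u` is the minimal-length representative `ᴶw` of the right coset `W_J w`. -/
def IsMinRep (J : Set B) (w u : W) : Prop :=
  (∃ p ∈ parabolic cs J, u = p * w) ∧
    ∀ v : W, (∃ p ∈ parabolic cs J, v = p * w) → cs.length u ≤ cs.length v

/-- A map `f : W → W` is compulsive if `f(w) ≤_R w` and `f(w) ≤_R ws` for every
right descent `s` of `w`. -/
def Compulsive (f : W → W) : Prop :=
  ∀ w : W, rweakLE cs (f w) w ∧ ∀ i ∈ D cs w, rweakLE cs (f w) (w * cs.simple i)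

/-- The strong Bruhat order: `x ≤ y` iff some reduced word for `y` contains a
reduced word for `x` as a (not necessarily contiguous) subword. -/
def bruhatLE (x y : W) : Prop :=
  ∃ ω : List B, cs.wordProd ω = y ∧ ω.length = cs.length y ∧
    ∃ ω' : List B, ω'.Sublist ω ∧ cs.wordProd ω' = x ∧ ω'.length = cs.length x

/-- The Coxeter system is irreducible: its Coxeter diagram is connected, i.e. the
index set admits no nontrivial partition into two mutually commuting parts. -/
def Irreducible : Prop :=
  ∀ J : Set B, (∀ i ∈ J, ∀ j ∈ Jᶜ, M i j = 2) → J = ∅ ∨ J = Set.univ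

theorem functionEnd_mul_apply {α : Type*} (g h : Function.End α) (a : α) :
    (g * h) a = g (h a) := rfl

theorem functionEnd_one_apply {α : Type*} (a : α) : (1 : Function.End α) a = a := rfl

open Classical in
/-- The action of the `i`-th simple reflection on signed group elements: conjugation, with a
change of sign at `s i` itself. -/
noncomputable def signedConj (i : B) : Function.End (W × ZMod 2) := fun x =>
  (cs.simple i * x.1 * cs.simple i, x.2 + if x.1 = cs.simple i then 1 else 0)

open Classical in
theorem signedConj_mul_pow_apply (i j : B) (n : ℕ) (t : W) (ε : ZMod 2) :
    ((signedConj cs i * signedConj cs j) ^ n) (t, ε) =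
      ((cs.simple i * cs.simple j) ^ n * t * ((cs.simple i * cs.simple j) ^ n)⁻¹,
        ε + ∑ k ∈ Finset.range (2 * n),
          if t = cs.simple j * (cs.simple i * cs.simple j) ^ k then 1 else 0) := by
  induction n with
  | zero => simp [functionEnd_one_apply]
  | succ n ih =>
    set c := cs.simple i * cs.simple j with hc
    have hflip : ∀ k : ℕ, (c ^ k)⁻¹ * cs.simple j = cs.simple j * c ^ k := by
      intro k
      induction k with
      | zero => simp
      | succ k ihk =>
        rw [pow_succ, mul_inv_rev, mul_assoc, ihk, ← pow_succ, pow_succ']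
        simp [hc, mul_assoc]
    have hfst : c ^ n * t * (c ^ n)⁻¹ = cs.simple j ↔ t = cs.simple j * c ^ (2 * n) := by
      rw [two_mul, pow_add, ← mul_assoc, ← hflip, mul_inv_eq_iff_eq_mul, mul_assoc (c ^ n)⁻¹,
        eq_inv_mul_iff_mul_eq]
    have hsnd : cs.simple j * (c ^ n * t * (c ^ n)⁻¹) * cs.simple j = cs.simple i ↔
        t = cs.simple j * c ^ (2 * n + 1) := by
      have hexp : cs.simple j * c ^ (2 * n + 1) =
          (c ^ n)⁻¹ * (cs.simple j * cs.simple i * cs.simple j) * c ^ n := by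
        rw [show 2 * n + 1 = n + 1 + n by omega, pow_add, pow_succ, ← mul_assoc, ← mul_assoc,
          ← hflip, hc]
        simp [mul_assoc]
      rw [hexp]
      constructor
      · intro h
        rw [← h]
        simp [mul_assoc]
      · rintro rfl
        simp [mul_assoc]
    rw [pow_succ', functionEnd_mul_apply, ih, functionEnd_mul_apply, signedConj, signedConj]
    simp only [hfst, hsnd]
    rw [show 2 * (n + 1) = 2 * n + 1 + 1 by omega, Finset.sum_range_succ, Finset.sum_range_succ]
    refine Prod.ext ?_ ?_
    · simp [pow_succ', hc, mul_assoc]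
    · simp only [add_assoc]

theorem isLiftable_signedConj : M.IsLiftable (signedConj cs) := by
  classical
  intro i j
  funext ⟨t, ε⟩
  rw [signedConj_mul_pow_apply, two_mul, Finset.sum_range_add]
  simp only [pow_add, cs.simple_mul_simple_pow, one_mul, CharTwo.add_self_eq_zero]
  simp [functionEnd_one_apply]

/-- The action of `W` on signed group elements extending `signedConj`. -/
noncomputable def signedAction : W →* Function.End (W × ZMod 2) :=
  cs.lift ⟨signedConj cs, isLiftable_signedConj cs⟩

theorem signedAction_simple (i : B) : signedAction cs (cs.simple i) = signedConj cs i :=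
  cs.lift_apply_simple (isLiftable_signedConj cs) i

open Classical in
theorem signedAction_wordProd_apply (ω : List B) (t : W) (ε : ZMod 2) :
    signedAction cs (cs.wordProd ω) (t, ε) =
      (cs.wordProd ω * t * (cs.wordProd ω)⁻¹, ε + (cs.rightInvSeq ω).count t) := by
  induction ω with
  | nil => simp [functionEnd_one_apply]
  | cons i ω ih =>
    have hiff : cs.wordProd ω * t * (cs.wordProd ω)⁻¹ = cs.simple i ↔
        (cs.wordProd ω)⁻¹ * cs.simple i * cs.wordProd ω = t := by
      rw [mul_inv_eq_iff_eq_mul, mul_assoc, inv_mul_eq_iff_eq_mul, eq_comm]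
    rw [cs.wordProd_cons, map_mul, functionEnd_mul_apply, ih,
      signedAction_simple, signedConj, CoxeterSystem.rightInvSeq, List.count_cons]
    simp only [hiff, beq_iff_eq]
    refine Prod.ext ?_ ?_
    · simp [mul_assoc]
    · push_cast
      simp only [add_assoc]

/-- The parity of the number of occurrences of `t` in the right inversion sequence of any word
for `w`. -/
noncomputable def invParity (w t : W) : ZMod 2 := (signedAction cs w (t, 0)).2

open Classical in
theorem invParity_wordProd (ω : List B) (t : W) :
    invParity cs (cs.wordProd ω) t = (cs.rightInvSeq ω).count t := by
  simp [invParity, signedAction_wordProd_apply]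

theorem invParity_mul (x y t : W) :
    invParity cs (x * y) t = invParity cs y t + invParity cs x (y * t * y⁻¹) := by
  classical
  obtain ⟨ω, rfl⟩ := cs.wordProd_surjective x
  obtain ⟨ω', rfl⟩ := cs.wordProd_surjective y
  simp only [invParity, map_mul, functionEnd_mul_apply,
    signedAction_wordProd_apply, zero_add]

theorem invParity_one (t : W) : invParity cs 1 t = 0 := by
  simp [invParity, functionEnd_one_apply]

theorem invParity_self {t : W} (ht : cs.IsReflection t) : invParity cs t t = 1 := by
  obtain ⟨x, i, rfl⟩ := ht
  have hinv := invParity_mul cs x x⁻¹ (x * cs.simple i * x⁻¹)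
  have hsimple : invParity cs (cs.simple i) (cs.simple i) = 1 := by
    classical
    simpa using invParity_wordProd cs [i] (cs.simple i)
  rw [mul_inv_cancel, invParity_one] at hinv
  rw [invParity_mul, invParity_mul cs x]
  simp only [mul_assoc, inv_inv, inv_mul_cancel, mul_one, one_mul, inv_mul_cancel_left,
    CoxeterSystem.inv_simple, CoxeterSystem.simple_mul_simple_self] at hinv ⊢
  rw [hsimple, add_left_comm, ← hinv, add_zero]

theorem length_mul_lt_of_invParity_ne_zero {w t : W} (h : invParity cs w t ≠ 0) :
    cs.length (w * t) < cs.length w := by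
  classical
  obtain ⟨ω, hω, rfl⟩ := cs.exists_isReduced w
  rw [invParity_wordProd] at h
  refine (cs.isRightInversion_of_mem_rightInvSeq hω ?_).2
  by_contra hmem
  simp [List.count_eq_zero_of_not_mem hmem] at h

theorem invParity_ne_zero_iff {w t : W} (ht : cs.IsReflection t) :
    invParity cs w t ≠ 0 ↔ cs.length (w * t) < cs.length w := by
  refine ⟨length_mul_lt_of_invParity_ne_zero cs, fun hlt h => ?_⟩
  have hmul : invParity cs (w * t) t ≠ 0 := by
    rw [invParity_mul, mul_inv_cancel_right, h, invParity_self cs ht]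
    decide
  have := length_mul_lt_of_invParity_ne_zero cs hmul
  rw [mul_assoc, ht.mul_self, mul_one] at this
  omega

/-- A right inversion of a product comes from a right inversion of one of the factors. -/
theorem right_inversion_mul {x y t : W} (ht : cs.IsReflection t)
    (h : cs.length (x * y * t) < cs.length (x * y)) :
    cs.length (y * t) < cs.length y ∨ cs.length (x * (y * t * y⁻¹)) < cs.length x := by
  rw [← invParity_ne_zero_iff cs ht, invParity_mul] at h
  rw [← invParity_ne_zero_iff cs ht, ← invParity_ne_zero_iff cs (ht.conj y)]
  by_contra! hcon
  simp [hcon.1, hcon.2] at h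

/-- A left inversion of a product comes from a left inversion of one of the factors. -/
theorem left_inversion_mul {x y t : W} (ht : cs.IsReflection t)
    (h : cs.length (t * (x * y)) < cs.length (x * y)) :
    cs.length (t * x) < cs.length x ∨ cs.length (x⁻¹ * t * x * y) < cs.length y := by
  have key := right_inversion_mul cs (x := y⁻¹) (y := x⁻¹) ht (by
    rw [← cs.length_inv (x * y), ← cs.length_inv (t * (x * y))] at h
    simpa [ht.inv, mul_assoc] using h)
  rw [← cs.length_inv (t * x), ← cs.length_inv x, ← cs.length_inv y,
    ← cs.length_inv (x⁻¹ * t * x * y)]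
  simpa [ht.inv, mul_assoc] using key

/-- The exchange property. -/
theorem exists_eraseIdx_of_isRightDescent {ω : List B} {i : B}
    (h : cs.IsRightDescent (cs.wordProd ω) i) :
    ∃ k < ω.length, cs.wordProd ω * cs.simple i = cs.wordProd (ω.eraseIdx k) := by
  classical
  have hne := (invParity_ne_zero_iff cs (cs.isReflection_simple i)).2 h
  rw [invParity_wordProd] at hne
  have hmem : cs.simple i ∈ cs.rightInvSeq ω := by
    by_contra hmem
    simp [List.count_eq_zero_of_not_mem hmem] at hne
  obtain ⟨k, hk, hki⟩ := List.mem_iff_getElem.1 hmem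
  refine ⟨k, by simpa using hk, ?_⟩
  rw [← cs.wordProd_mul_getD_rightInvSeq, List.getD_eq_getElem _ 1 hk, hki]

theorem exists_isReduced_of_mem_parabolic {J : Set B} {q : W} (hq : q ∈ parabolic cs J) :
    ∃ ω : List B, cs.IsReduced ω ∧ (∀ i ∈ ω, i ∈ J) ∧ cs.wordProd ω = q := by
  have step : ∀ x : W, (∃ ω : List B, cs.IsReduced ω ∧ (∀ i ∈ ω, i ∈ J) ∧ cs.wordProd ω = x) →
      ∀ i ∈ J, ∃ ω : List B, cs.IsReduced ω ∧ (∀ i ∈ ω, i ∈ J) ∧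
        cs.wordProd ω = x * cs.simple i := by
    rintro _ ⟨ω, hω, hJ, rfl⟩ i hi
    by_cases hdesc : cs.IsRightDescent (cs.wordProd ω) i
    · obtain ⟨k, hk, hprod⟩ := exists_eraseIdx_of_isRightDescent cs hdesc
      refine ⟨ω.eraseIdx k, ?_, fun j hj => hJ j (List.mem_of_mem_eraseIdx hj), hprod.symm⟩
      have hlen := cs.isRightDescent_iff.1 hdesc
      have herase := List.length_eraseIdx_add_one hk
      rw [hprod, hω.eq] at hlen
      rw [CoxeterSystem.IsReduced]
      omega
    · refine ⟨ω ++ [i], ?_, ?_, by simp [cs.wordProd_append]⟩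
      · have hlen := cs.not_isRightDescent_iff.1 hdesc
        rw [hω.eq] at hlen
        simpa [CoxeterSystem.IsReduced, cs.wordProd_append] using hlen
      · intro j hj
        rcases List.mem_append.1 hj with hj | hj
        · exact hJ j hj
        · rwa [List.mem_singleton.1 hj]
  induction hq using Subgroup.closure_induction_right with
  | one => exact ⟨[], by simp [CoxeterSystem.IsReduced], by simp, by simp⟩
  | mul_right x _ _ hy ih =>
    obtain ⟨i, hi, rfl⟩ := hy
    exact step x ih i hi
  | mul_inv_cancel x _ _ hy ih =>
    obtain ⟨i, hi, rfl⟩ := hy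
    rw [cs.inv_simple]
    exact step x ih i hi

theorem parabolic_induction_right {J : Set B} {P : W → Prop} (one : P 1)
    (mul_simple : ∀ q, ∀ i ∈ J, cs.length (q * cs.simple i) = cs.length q + 1 →
      P q → P (q * cs.simple i))
    {q : W} (hq : q ∈ parabolic cs J) : P q := by
  obtain ⟨ω, hω, hJ, rfl⟩ := exists_isReduced_of_mem_parabolic cs hq
  clear hq
  induction ω using List.reverseRecOn with
  | nil => simpa using one
  | append_singleton ω i ih =>
    have hω' : cs.IsReduced ω := by simpa using hω.take ω.length
    have hlen := hω.eq
    rw [cs.wordProd_append, cs.wordProd_singleton, List.length_append, List.length_singleton,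
      ← hω'.eq] at hlen
    rw [cs.wordProd_append, cs.wordProd_singleton]
    exact mul_simple _ i (hJ i (by simp)) hlen (ih hω' fun j hj => hJ j (by simp [hj]))

theorem parabolic_induction_left {J : Set B} {P : W → Prop} (one : P 1)
    (simple_mul : ∀ q, ∀ i ∈ J, cs.length (cs.simple i * q) = cs.length q + 1 →
      P q → P (cs.simple i * q))
    {q : W} (hq : q ∈ parabolic cs J) : P q := by
  have key : P q⁻¹⁻¹ := by
    refine parabolic_induction_right cs (P := fun x => P x⁻¹) (by simpa using one) ?_
      (inv_mem hq)
    intro x i hi hlen hx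
    rw [mul_inv_rev, cs.inv_simple]
    refine simple_mul _ i hi ?_ hx
    rw [← cs.length_inv, ← cs.length_inv x⁻¹]
    simpa using hlen
  simpa using key

/-- If all elements of `J` are right descents of `z`, then `z` admits a length-additive
factorization with any given element of `W_J` as right factor. -/
theorem length_mul_inv_add_of_subset_D {J : Set B} {z : W} (hz : J ⊆ D cs z) {q : W}
    (hq : q ∈ parabolic cs J) : cs.length (z * q⁻¹) + cs.length q = cs.length z := by
  refine parabolic_induction_right cs
    (P := fun q => cs.length (z * q⁻¹) + cs.length q = cs.length z) (by simp) ?_ hq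
  intro q i hi hlen ih
  have hdesc : cs.length (z * q⁻¹ * q * cs.simple i) < cs.length (z * q⁻¹ * q) := by
    rw [inv_mul_cancel_right]
    exact hz hi
  have hle := cs.length_le_length_mul_add_right z (q * cs.simple i)⁻¹
  rw [cs.length_inv] at hle
  rcases right_inversion_mul cs (cs.isReflection_simple i) hdesc with h | h
  · omega
  · have heq : z * q⁻¹ * (q * cs.simple i * q⁻¹) = z * (q * cs.simple i)⁻¹ := by
      simp [mul_assoc]
    rw [heq] at h
    omega

theorem w0_mem_parabolic (J : Set B) : w0 cs J ∈ parabolic cs J := by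
  unfold w0
  split_ifs with h
  · exact h.choose_spec.1
  · exact one_mem _

theorem length_mul_w0_add_of_subset_D {J : Set B} {z : W} (hz : J ⊆ D cs z) :
    cs.length (z * w0 cs J) + cs.length (w0 cs J) = cs.length z := by
  simpa using length_mul_inv_add_of_subset_D cs hz (inv_mem (w0_mem_parabolic cs J))

/-- `Pop v` is above every common lower bound of `v` and its lower covers. -/
theorem rweakLE_Pop {u v : W} (huv : rweakLE cs u v)
    (hcov : ∀ i ∈ D cs v, rweakLE cs u (v * cs.simple i)) : rweakLE cs u (Pop cs v) := by
  have hz : D cs v ⊆ D cs (u⁻¹ * v) := by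
    intro i hi
    have hui := hcov i hi
    have hlt : cs.length (v * cs.simple i) < cs.length v := hi
    unfold rweakLE at huv hui
    change cs.length (u⁻¹ * v * cs.simple i) < cs.length (u⁻¹ * v)
    rw [mul_assoc]
    omega
  have h₁ := length_mul_w0_add_of_subset_D cs (subset_refl (D cs v))
  have h₂ := length_mul_w0_add_of_subset_D cs hz
  rw [mul_assoc] at h₂
  unfold rweakLE Pop at *
  omega

/-- Left multiplication of `v` by elements of `W_J` adds lengths. -/
def IsLeftAdditive (J : Set B) (v : W) : Prop :=
  ∀ q ∈ parabolic cs J, cs.length (q * v) = cs.length q + cs.length v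

theorem IsMinRep.isLeftAdditive {J : Set B} {w v : W} (hv : IsMinRep cs J w v) :
    IsLeftAdditive cs J v := by
  obtain ⟨⟨p, hp, rfl⟩, hmin⟩ := hv
  intro q hq
  suffices h : q ∈ parabolic cs J ∧
      cs.length (q * (p * w)) = cs.length q + cs.length (p * w) from h.2
  refine parabolic_induction_left cs (P := fun q => q ∈ parabolic cs J ∧
    cs.length (q * (p * w)) = cs.length q + cs.length (p * w)) (by simp [one_mem]) ?_ hq
  rintro q i hi hlen ⟨hq, ih⟩
  have hsi : cs.simple i ∈ parabolic cs J := Subgroup.subset_closure ⟨i, hi, rfl⟩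
  refine ⟨mul_mem hsi hq, ?_⟩
  rw [mul_assoc]
  rcases cs.length_simple_mul (q * (p * w)) i with h | h
  · omega
  · rcases left_inversion_mul cs (cs.isReflection_simple i)
      (show cs.length (cs.simple i * (q * (p * w))) < cs.length (q * (p * w)) by omega)
      with h' | h'
    · omega
    · have := hmin (q⁻¹ * cs.simple i * q * (p * w)) ⟨q⁻¹ * cs.simple i * q * p,
        mul_mem (mul_mem (mul_mem (inv_mem hq) hsi) hq) hp, by simp [mul_assoc]⟩
      omega

theorem IsLeftAdditive.mul_simple {J : Set B} {v : W} (hv : IsLeftAdditive cs J v) {i : B}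
    (hi : i ∈ D cs v) : IsLeftAdditive cs J (v * cs.simple i) := by
  intro q hq
  have hqv := hv q hq
  have hdesc := cs.isRightDescent_iff.1 hi
  have hle := cs.length_mul_le q (v * cs.simple i)
  have hge := cs.length_mul_simple (q * v) i
  rw [mul_assoc] at hge
  omega

theorem rweakLE_of_rweakLE_parabolic_mul {J : Set B} {u v : W} (hu : IsLeftAdditive cs J u)
    (hv : IsLeftAdditive cs J v) {q : W} (hq : q ∈ parabolic cs J)
    (h : rweakLE cs u (q * v)) : rweakLE cs u v := by
  suffices hP : q ∈ parabolic cs J ∧ (rweakLE cs u (q * v) → rweakLE cs u v) from hP.2 h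
  refine parabolic_induction_left cs (P := fun q => q ∈ parabolic cs J ∧
    (rweakLE cs u (q * v) → rweakLE cs u v)) (by simp [one_mem]) ?_ hq
  rintro q i hi hlen ⟨hq, ih⟩
  have hsi : cs.simple i ∈ parabolic cs J := Subgroup.subset_closure ⟨i, hi, rfl⟩
  refine ⟨mul_mem hsi hq, fun hle => ih ?_⟩
  have hu' := hu _ hsi
  have hqv := hv _ hq
  have hsqv := hv _ (mul_mem hsi hq)
  have hinv : cs.length (cs.simple i * (u * (u⁻¹ * (cs.simple i * q * v)))) <
      cs.length (u * (u⁻¹ * (cs.simple i * q * v))) := by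
    simp only [mul_inv_cancel_left, mul_assoc, cs.simple_mul_simple_cancel_left] at hsqv ⊢
    omega
  have htri := cs.length_mul_le u (u⁻¹ * (q * v))
  rw [mul_inv_cancel_left] at htri
  rw [cs.length_simple] at hu'
  unfold rweakLE at hle ⊢
  rcases left_inversion_mul cs (cs.isReflection_simple i) hinv with h' | h'
  · omega
  · have heq : u⁻¹ * cs.simple i * u * (u⁻¹ * (cs.simple i * q * v)) = u⁻¹ * (q * v) := by
      simp [mul_assoc]
    rw [heq] at h'
    omega

/-- Passing to minimal representatives of the cosets `W_J w` preserves the right weak order. -/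
theorem rweakLE_of_parabolic_mul_rweakLE {J : Set B} {u v : W} (hu : IsLeftAdditive cs J u)
    (hv : IsLeftAdditive cs J v) {p q : W} (hp : p ∈ parabolic cs J) (hq : q ∈ parabolic cs J)
    (h : rweakLE cs (p * u) (q * v)) : rweakLE cs u v := by
  refine rweakLE_of_rweakLE_parabolic_mul cs hu hv (mul_mem (inv_mem hp) hq) ?_
  have hpu := hu p hp
  have h₁ := cs.length_mul_le u (u⁻¹ * (p⁻¹ * q * v))
  have h₂ := cs.length_mul_le p (p⁻¹ * q * v)
  unfold rweakLE at h ⊢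
  simp only [mul_inv_rev, mul_assoc, mul_inv_cancel_left] at h h₁ h₂ ⊢
  omega

/-- if `f` is compulsive, then `ᴶ(f(w)) ≤_R Pop(ᴶw)` for every `w`. -/
theorem minRep_compulsive_le_pop_minRep (J : Set B) (f : W → W) (hf : Compulsive cs f)
    (w u v : W) (hu : IsMinRep cs J (f w) u) (hv : IsMinRep cs J w v) :
    rweakLE cs u (Pop cs v) := by
  obtain ⟨p, hp, hup⟩ := hu.1
  obtain ⟨q, hq, hvq⟩ := hv.1
  have hua := hu.isLeftAdditive
  have hva := hv.isLeftAdditive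
  have hfw : f w = p⁻¹ * u := by rw [hup, inv_mul_cancel_left]
  have hw : w = q⁻¹ * v := by rw [hvq, inv_mul_cancel_left]
  obtain ⟨hle, hcov⟩ := hf w
  rw [hfw] at hle hcov
  refine rweakLE_Pop cs
    (rweakLE_of_parabolic_mul_rweakLE cs hua hva (inv_mem hp) (inv_mem hq) (hw ▸ hle)) ?_
  intro i hi
  have hva' := hva.mul_simple cs hi
  refine rweakLE_of_parabolic_mul_rweakLE cs hua hva' (inv_mem hp) (inv_mem hq) ?_
  have hws : q⁻¹ * (v * cs.simple i) = w * cs.simple i := by rw [hw, mul_assoc]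
  rw [hws]
  refine hcov i ?_
  have hadd := hva _ (inv_mem hq)
  have hadd' := hva' _ (inv_mem hq)
  rw [hws] at hadd'
  rw [← hw] at hadd
  have hlt : cs.length (v * cs.simple i) < cs.length v := hi
  change cs.length (w * cs.simple i) < cs.length w
  omega

end CoxPop
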